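/- arXiv:2009.00716 — 2 statements merged into one kernel-verified Lean document; each statement's English description precedes it below -/
import Mathlib

section
/- Let p be a prime, let M, H₁, H₂ be n×n matrices over ℤ_p with M invertible, let m be a positive integer, and set A = Σ_{i=0}^{m-1} H₁^i · M · H₂^i. Then det((H₁·A·H₂ + M − A) · M⁻¹) = (det(H₁) · det(H₂))^m. -/
/-- The telescoping identity for the sums `∑_{i<m} a^i x b^i` in a ring. -/
theorem mul_sum_pow_mul_pow_mul_add_sub {R : Type*} [Ring R] (a x b : R) (m : ℕ) :
    a * (∑ i ∈ Finset.range m, a ^ i * x * b ^ i) * b + x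
      - ∑ i ∈ Finset.range m, a ^ i * x * b ^ i = a ^ m * x * b ^ m := by
  have h : a * (∑ i ∈ Finset.range m, a ^ i * x * b ^ i) * b =
      ∑ i ∈ Finset.range m, a ^ (i + 1) * x * b ^ (i + 1) := by
    simp only [Finset.mul_sum, Finset.sum_mul, pow_succ' a, pow_succ b, mul_assoc]
  have h' := Finset.sum_range_sub (fun i => a ^ i * x * b ^ i) m
  simp only [Finset.sum_sub_distrib, pow_zero, one_mul, mul_one] at h'
  rw [h, add_sub_right_comm, h', sub_add_cancel]

/-- Dan Brown's determinant attack on MAKE: with `M` invertible and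
`A = ∑_{i=0}^{m-1} H₁^i M H₂^i`, the determinant of the publicly computable matrix
`(H₁ A H₂ + M - A)·M⁻¹` equals `(det H₁ · det H₂)^m`. -/
theorem make_determinant_attack (p : ℕ) [Fact p.Prime] (d : ℕ)
    (M H₁ H₂ : Matrix (Fin d) (Fin d) (ZMod p)) (hM : IsUnit M.det)
    (m : ℕ) (hm : 0 < m)
    (A : Matrix (Fin d) (Fin d) (ZMod p))
    (hA : A = ∑ i ∈ Finset.range m, H₁ ^ i * M * H₂ ^ i) :
    ((H₁ * A * H₂ + M - A) * M⁻¹).det = (H₁.det * H₂.det) ^ m := by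
  rw [hA, mul_sum_pow_mul_pow_mul_add_sub]
  simp only [Matrix.det_mul, Matrix.det_pow, Matrix.det_nonsing_inv]
  calc H₁.det ^ m * M.det * H₂.det ^ m * Ring.inverse M.det
      = (H₁.det * H₂.det) ^ m * (M.det * Ring.inverse M.det) := by ring
    _ = (H₁.det * H₂.det) ^ m := by rw [Ring.mul_inverse_cancel _ hM, mul_one]
end

section
/- Let p be a prime, let M and H be invertible n×n matrices over ℤ_p, let m be a nonnegative integer, and set A' = Σ_{i=0}^{m} M·H^i. Then H^{m+1} = M⁻¹·A'·(H − I) + I, where I is the identity matrix. In particular, the adversary can recover H^{m+1} from the public data M, H, A'. -/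
/-- The factoring attack on a one-sided variant of MAKE: with `M` and `H` invertible and
`A' = ∑_{i=0}^{m} M·H^i`, the power `H^{m+1}` is publicly computable:
`H^{m+1} = M⁻¹·A'·(H - I) + I`. -/
theorem make_one_sided_attack (p : ℕ) [Fact p.Prime] (d : ℕ)
    (M H : Matrix (Fin d) (Fin d) (ZMod p))
    (hM : IsUnit M.det) (hH : IsUnit H.det) (m : ℕ)
    (A' : Matrix (Fin d) (Fin d) (ZMod p))
    (hA' : A' = ∑ i ∈ Finset.range (m + 1), M * H ^ i) :
    H ^ (m + 1) = M⁻¹ * A' * (H - 1) + 1 := by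
  rw [hA', ← Finset.mul_sum, Matrix.nonsing_inv_mul_cancel_left _ _ hM, geom_sum_mul,
    sub_add_cancel]
end
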